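/- Let λ be a partition of n with exactly m removable squares. Then m·f_λ + Σ_{ν ∈ Λ⁺⁻} f_ν = n · Σ_{μ ∈ Λ⁻} f_μ, where Λ⁻ is the set of partitions of n−1 obtained from λ by removing one square and Λ⁺⁻ is the set of partitions ν ≠ λ of n obtained from λ by adding one square and then removing a different square. -/

import Mathlib

/-- A standard Young tableau of shape `μ`, encoded as a function on cells
(`0` outside the diagram) which is a bijection from the cells of `μ` onto
`{1, …, μ.card}` and strictly increases along rows and along columns. -/
def IsSYT (μ : YoungDiagram) (T : ℕ × ℕ → ℕ) : Prop :=
  Set.BijOn T (μ.cells : Set (ℕ × ℕ)) (Set.Icc 1 μ.card) ∧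
  (∀ i j1 j2 : ℕ, j1 < j2 → (i, j2) ∈ μ → T (i, j1) < T (i, j2)) ∧
  (∀ i1 i2 j : ℕ, i1 < i2 → (i2, j) ∈ μ → T (i1, j) < T (i2, j)) ∧
  (∀ c : ℕ × ℕ, c ∉ μ → T c = 0)

/-- `f_μ`, the number of standard Young tableaux of shape `μ`. -/
noncomputable def sytCard (μ : YoungDiagram) : ℕ :=
  Nat.card {T : ℕ × ℕ → ℕ // IsSYT μ T}

/-- `c` is a removable square of the Young diagram `μ`. -/
def Removable (μ : YoungDiagram) (c : ℕ × ℕ) : Prop :=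
  c ∈ μ ∧ ∃ ν : YoungDiagram, ν.cells = μ.cells.erase c

/-- `c` is an addible square of the Young diagram `μ`. -/
def Addible (μ : YoungDiagram) (c : ℕ × ℕ) : Prop :=
  c ∉ μ ∧ ∃ ν : YoungDiagram, ν.cells = insert c μ.cells


namespace YoungDiagram

instance : DecidableEq YoungDiagram := fun _ _ => decidable_of_iff _ YoungDiagram.ext_iff.symm

instance : DecidableLE YoungDiagram := fun _ _ => decidable_of_iff _ cells_subset_iff

theorem card_le_card {μ ν : YoungDiagram} (h : μ ≤ ν) : μ.card ≤ ν.card :=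
  Finset.card_le_card (cells_subset_iff.2 h)

theorem eq_of_le_of_card_le {μ ν : YoungDiagram} (h : μ ≤ ν) (hc : ν.card ≤ μ.card) : μ = ν :=
  YoungDiagram.ext (Finset.eq_of_subset_of_card_le (cells_subset_iff.2 h) hc)

theorem card_sup_add_card_inf (μ ν : YoungDiagram) :
    (μ ⊔ ν).card + (μ ⊓ ν).card = μ.card + ν.card := by
  simp only [YoungDiagram.card, cells_sup, cells_inf]
  exact Finset.card_union_add_card_inter _ _

theorem card_lt_card_sup {μ ν : YoungDiagram} (hc : μ.card = ν.card) (hne : μ ≠ ν) :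
    μ.card < (μ ⊔ ν).card := by
  by_contra! h
  have h1 := eq_of_le_of_card_le (le_sup_left : μ ≤ μ ⊔ ν) h
  have h2 : ν ≤ μ := sup_eq_left.1 h1.symm
  exact hne (eq_of_le_of_card_le h2 hc.le).symm

theorem exists_cells_eq_insert {μ ν : YoungDiagram} (h : μ ≤ ν) (hc : μ.card + 1 = ν.card) :
    ∃ c, c ∉ μ ∧ ν.cells = insert c μ.cells := by
  have hs := cells_subset_iff.2 h
  have h1 : (ν.cells \ μ.cells).card = 1 := by
    rw [Finset.card_sdiff_of_subset hs]
    simp only [YoungDiagram.card] at hc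
    omega
  obtain ⟨c, hc⟩ := Finset.card_eq_one.1 h1
  refine ⟨c, ?_, ?_⟩
  · have : c ∈ ν.cells \ μ.cells := by simp [hc]
    simpa using (Finset.mem_sdiff.1 this).2
  · rw [Finset.insert_eq, ← hc, Finset.sdiff_union_of_subset hs]

theorem finite_card_eq (n : ℕ) : {μ : YoungDiagram | μ.card = n}.Finite := by
  refine Set.Finite.of_finite_image (f := YoungDiagram.cells) ?_
    (fun _ _ _ _ h => YoungDiagram.ext h)
  refine (Finset.finite_toSet (Finset.range n ×ˢ Finset.range n).powerset).subset ?_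
  rintro _ ⟨μ, rfl, rfl⟩
  simp only [Finset.coe_powerset, Set.mem_preimage, Set.mem_powerset_iff, Finset.coe_subset]
  rintro ⟨i, j⟩ hij
  rw [mem_cells] at hij
  have hr : μ.rowLen i ≤ μ.card := by
    rw [rowLen_eq_card]; exact Finset.card_le_card (Finset.filter_subset _ _)
  have hc : μ.colLen j ≤ μ.card := by
    rw [colLen_eq_card]; exact Finset.card_le_card (Finset.filter_subset _ _)
  have h1 := mem_iff_lt_rowLen.1 hij
  have h2 := mem_iff_lt_colLen.1 hij
  simp only [Finset.mem_product, Finset.mem_range]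
  omega

/-- The Young diagrams with `n` cells. -/
noncomputable def ofCard (n : ℕ) : Finset YoungDiagram := (finite_card_eq n).toFinset

@[simp]
theorem mem_ofCard {n : ℕ} {μ : YoungDiagram} : μ ∈ ofCard n ↔ μ.card = n := by
  simp [ofCard]

/-- The diagram obtained by appending a cell to row `i`. -/
def appendCell (μ : YoungDiagram) (i : ℕ) (hi : ∀ k < i, μ.rowLen i < μ.rowLen k) :
    YoungDiagram where
  cells := insert (i, μ.rowLen i) μ.cells
  isLowerSet := by
    rintro ⟨a, b⟩ ⟨a', b'⟩ hle h
    simp only [Prod.mk_le_mk] at hle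
    simp only [Finset.coe_insert, Set.mem_insert_iff, Prod.mk.injEq, Finset.mem_coe, mem_cells]
      at h ⊢
    rcases h with ⟨rfl, rfl⟩ | h
    · rcases hle.1.lt_or_eq with h1 | rfl
      · right
        have := hi _ h1
        rw [mem_iff_lt_rowLen]; omega
      · rw [mem_iff_lt_rowLen]; omega
    · exact Or.inr (μ.up_left_mem hle.1 hle.2 h)

/-- The diagram obtained by erasing the last cell of row `i`. -/
def eraseCell (μ : YoungDiagram) (i : ℕ) (hi : μ.rowLen (i + 1) < μ.rowLen i) :
    YoungDiagram where
  cells := μ.cells.erase (i, μ.rowLen i - 1)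
  isLowerSet := by
    rintro ⟨a, b⟩ ⟨a', b'⟩ hle h
    simp only [Prod.mk_le_mk] at hle
    simp only [Finset.coe_erase, Set.mem_sdiff, Set.mem_singleton_iff, Prod.mk.injEq,
      Finset.mem_coe, mem_cells] at h ⊢
    refine ⟨μ.up_left_mem hle.1 hle.2 h.1, ?_⟩
    rintro ⟨rfl, rfl⟩
    have hb := mem_iff_lt_rowLen.1 h.1
    rcases hle.1.lt_or_eq with h1 | rfl
    · have := μ.rowLen_anti _ _ (Nat.succ_le_of_lt h1)
      simp only [Nat.succ_eq_add_one] at this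
      omega
    · have := h.2
      omega

/-- The rows of `μ` whose last cell can be removed. -/
def removableRows (μ : YoungDiagram) : Finset ℕ :=
  (Finset.range (μ.colLen 0)).filter fun i => μ.rowLen (i + 1) < μ.rowLen i

theorem mem_removableRows {μ : YoungDiagram} {i : ℕ} :
    i ∈ μ.removableRows ↔ μ.rowLen (i + 1) < μ.rowLen i := by
  simp only [removableRows, Finset.mem_filter, Finset.mem_range, and_iff_right_iff_imp]
  intro h
  rw [← mem_iff_lt_colLen, mem_iff_lt_rowLen]
  omega

theorem card_covers_below (n : ℕ) (μ : YoungDiagram) (hμ : μ.card = n + 1) :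
    ((ofCard n).filter (· ≤ μ)).card = μ.removableRows.card := by
  symm
  refine Finset.card_bij (fun i hi => μ.eraseCell i (mem_removableRows.1 hi)) ?_ ?_ ?_
  · intro i hi
    have hi' := mem_removableRows.1 hi
    have hmem : (i, μ.rowLen i - 1) ∈ μ.cells := by
      rw [mem_cells, mem_iff_lt_rowLen]; omega
    simp only [Finset.mem_filter, mem_ofCard]
    refine ⟨?_, ?_⟩
    · have := Finset.card_erase_of_mem hmem
      simp only [YoungDiagram.card, eraseCell] at hμ ⊢
      omega
    · rw [← cells_subset_iff]
      exact Finset.erase_subset _ _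
  · intro i hi k hk h
    have h' := congrArg YoungDiagram.cells h
    simp only [eraseCell] at h'
    have hi' := mem_removableRows.1 hi
    have hmem : (i, μ.rowLen i - 1) ∈ μ.cells := by
      rw [mem_cells, mem_iff_lt_rowLen]; omega
    by_contra hne
    have h2 : (i, μ.rowLen i - 1) ∈ μ.cells.erase (k, μ.rowLen k - 1) := by
      simp only [Finset.mem_erase, ne_eq, Prod.mk.injEq]
      exact ⟨fun h => hne h.1, hmem⟩
    rw [← h'] at h2
    simp at h2
  · intro ν hν
    simp only [Finset.mem_filter, mem_ofCard] at hν
    obtain ⟨⟨i, j⟩, hc, hins⟩ := exists_cells_eq_insert hν.2 (by omega)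
    have hmem : ∀ x, x ∈ μ ↔ x = (i, j) ∨ x ∈ ν := by
      intro x; rw [← mem_cells, hins]; simp
    have h0 : j < μ.rowLen i := by rw [← mem_iff_lt_rowLen, hmem]; simp
    have h1 : ¬ j + 1 < μ.rowLen i := by
      rw [← mem_iff_lt_rowLen, hmem]
      rintro (h | h)
      · simp at h
      · exact hc (ν.up_left_mem le_rfl (by omega) h)
    have h2 : ¬ j < μ.rowLen (i + 1) := by
      rw [← mem_iff_lt_rowLen, hmem]
      rintro (h | h)
      · simp at h
      · exact hc (ν.up_left_mem (by omega) le_rfl h)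
    have hj : μ.rowLen i - 1 = j := by omega
    refine ⟨i, mem_removableRows.2 (by omega), ?_⟩
    apply YoungDiagram.ext
    simp only [eraseCell, hj, hins]
    exact Finset.erase_insert (by simpa using hc)

theorem card_covers_above (n : ℕ) (μ : YoungDiagram) (hμ : μ.card = n) :
    ((ofCard (n + 1)).filter (μ ≤ ·)).card = μ.removableRows.card + 1 := by
  have hrows : ∀ i ∈ insert 0 (μ.removableRows.image Nat.succ),
      ∀ k < i, μ.rowLen i < μ.rowLen k := by
    intro i hi k hk
    simp only [Finset.mem_insert, Finset.mem_image] at hi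
    rcases hi with rfl | ⟨r, hr, rfl⟩
    · omega
    · exact (mem_removableRows.1 hr).trans_le (μ.rowLen_anti _ _ (by omega))
  have hcard : (insert 0 (μ.removableRows.image Nat.succ)).card = μ.removableRows.card + 1 := by
    rw [Finset.card_insert_of_notMem (by simp),
      Finset.card_image_of_injective _ Nat.succ_injective]
  rw [← hcard]
  symm
  refine Finset.card_bij (fun i hi => μ.appendCell i (hrows i hi)) ?_ ?_ ?_
  · intro i hi
    simp only [Finset.mem_filter, mem_ofCard]
    refine ⟨?_, ?_⟩
    · have := Finset.card_insert_of_notMem (s := μ.cells) (a := (i, μ.rowLen i))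
        (by rw [mem_cells, mem_iff_lt_rowLen]; omega)
      simp only [YoungDiagram.card, appendCell] at hμ ⊢
      omega
    · rw [← cells_subset_iff]
      exact Finset.subset_insert _ _
  · intro i hi k hk h
    have h' := congrArg YoungDiagram.cells h
    simp only [appendCell] at h'
    have h2 : (i, μ.rowLen i) ∈ insert (k, μ.rowLen k) μ.cells := by rw [← h']; simp
    simp only [Finset.mem_insert, Prod.mk.injEq, mem_cells, mem_iff_lt_rowLen, lt_irrefl,
      or_false] at h2
    exact h2.1
  · intro ν hν
    simp only [Finset.mem_filter, mem_ofCard] at hν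
    obtain ⟨⟨i, j⟩, hc, hins⟩ := exists_cells_eq_insert hν.2 (by omega)
    have hmem : ∀ x, x ∈ ν ↔ x = (i, j) ∨ x ∈ μ := by
      intro x; rw [← mem_cells, hins]; simp
    have hij : (i, j) ∈ ν := by rw [hmem]; simp
    rw [mem_iff_lt_rowLen] at hc
    have h1 : ¬ μ.rowLen i < j := by
      intro h
      have := (hmem _).1 (ν.up_left_mem le_rfl h.le hij)
      rw [mem_iff_lt_rowLen] at this
      simp only [Prod.mk.injEq, lt_irrefl, or_false] at this
      omega
    have hj : μ.rowLen i = j := by omega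
    have hi : i ∈ insert 0 (μ.removableRows.image Nat.succ) := by
      rcases i with _ | i
      · simp
      · refine Finset.mem_insert_of_mem (Finset.mem_image_of_mem _ (mem_removableRows.2 ?_))
        have := (hmem _).1 (ν.up_left_mem (Nat.le_succ i) le_rfl hij)
        rw [mem_iff_lt_rowLen] at this
        simp only [Prod.mk.injEq] at this
        omega
    refine ⟨i, hi, ?_⟩
    apply YoungDiagram.ext
    simp only [appendCell, hj, hins]

end YoungDiagram

open YoungDiagram

theorem IsSYT.lt_of_le {μ : YoungDiagram} {T : ℕ × ℕ → ℕ} (hT : IsSYT μ T) {a b : ℕ × ℕ}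
    (hb : b ∈ μ) (hle : a ≤ b) (hne : a ≠ b) : T a < T b := by
  obtain ⟨a1, a2⟩ := a
  obtain ⟨b1, b2⟩ := b
  obtain ⟨h1, h2⟩ := Prod.mk_le_mk.1 hle
  have hmid : (a1, b2) ∈ μ := μ.up_left_mem h1 le_rfl hb
  rcases h1.lt_or_eq with h1 | rfl
  · rcases h2.lt_or_eq with h2 | rfl
    · exact (hT.2.1 _ _ _ h2 hmid).trans (hT.2.2.1 _ _ _ h1 hb)
    · exact hT.2.2.1 _ _ _ h1 hb
  · rcases h2.lt_or_eq with h2 | rfl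
    · exact hT.2.1 _ _ _ h2 hb
    · exact absurd rfl hne

instance finite_isSYT (μ : YoungDiagram) : Finite {T : ℕ × ℕ → ℕ // IsSYT μ T} := by
  refine Finite.of_injective
    (β := μ.cells → Fin (μ.card + 1))
    (fun T c => ⟨T.1 c, Nat.lt_succ_of_le (T.2.1.mapsTo c.2).2⟩) ?_
  rintro ⟨T, hT⟩ ⟨S, hS⟩ h
  refine Subtype.ext (funext fun c => ?_)
  by_cases hc : c ∈ μ
  · have := congrFun h ⟨c, hc⟩
    simpa using this
  · exact (hT.2.2.2 c hc).trans (hS.2.2.2 c hc).symm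

/-- Extend a filling of `μ` to `l` by putting the entry `l.card` on the cells outside `μ`. -/
def extendFilling (l μ : YoungDiagram) (T : ℕ × ℕ → ℕ) (c : ℕ × ℕ) : ℕ :=
  if c ∈ μ then T c else if c ∈ l then l.card else 0

theorem IsSYT.isSYT_extendFilling {l μ : YoungDiagram} {T : ℕ × ℕ → ℕ} (hT : IsSYT μ T)
    (hle : μ ≤ l) (hcard : μ.card + 1 = l.card) : IsSYT l (extendFilling l μ T) := by
  obtain ⟨c, hc, hins⟩ := exists_cells_eq_insert hle hcard
  have hmem : ∀ x, x ∈ l ↔ x = c ∨ x ∈ μ := by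
    intro x; rw [← mem_cells, hins]; simp
  have hcl : c ∈ l := (hmem c).2 (Or.inl rfl)
  have hval : extendFilling l μ T c = l.card := by simp [extendFilling, hc, hcl]
  have hlt : ∀ a b : ℕ × ℕ, a ≤ b → a ≠ b → b ∈ l →
      extendFilling l μ T a < extendFilling l μ T b := by
    intro a b hab hne hb
    rcases (hmem b).1 hb with rfl | hbμ
    · have ha : a ∈ μ :=
        ((hmem a).1 (l.isLowerSet hab hb)).resolve_left hne
      rw [hval, extendFilling, if_pos ha]
      have := (hT.1.mapsTo ha).2
      omega
    · have ha : a ∈ μ := μ.isLowerSet hab hbμ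
      rw [extendFilling, extendFilling, if_pos ha, if_pos hbμ]
      exact hT.lt_of_le hbμ hab hne
  refine ⟨?_, ?_, ?_, ?_⟩
  · have hb : Set.BijOn (extendFilling l μ T) (μ.cells : Set (ℕ × ℕ))
        (Set.Icc 1 μ.card) :=
      hT.1.congr fun x hx => by
        have : x ∈ μ := hx
        simp [extendFilling, this]
    have := hb.insert (a := c) (by rw [hval]; simp; omega)
    rw [hins, Finset.coe_insert]
    convert this using 1
    ext k
    rw [hval]
    simp only [Set.mem_Icc, Set.mem_insert_iff]
    omega
  · intro i j1 j2 h hm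
    exact hlt _ _ (Prod.mk_le_mk.2 ⟨le_rfl, h.le⟩) (by simp; omega) hm
  · intro i1 i2 j h hm
    exact hlt _ _ (Prod.mk_le_mk.2 ⟨h.le, le_rfl⟩) (by simp; omega) hm
  · intro x hx
    have : x ∉ μ := fun h => hx (hle h)
    simp [extendFilling, this, hx]

theorem mem_iff_extendFilling_lt {l μ : YoungDiagram} {T : ℕ × ℕ → ℕ} (hT : IsSYT μ T)
    (hle : μ ≤ l) (hcard : μ.card + 1 = l.card) (c : ℕ × ℕ) :
    c ∈ μ ↔ c ∈ l ∧ extendFilling l μ T c < l.card := by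
  refine ⟨fun h => ⟨hle h, ?_⟩, fun h => ?_⟩
  · rw [extendFilling, if_pos h]
    have := (hT.1.mapsTo h).2
    omega
  · by_contra hc
    simp [extendFilling, hc, h.1] at h

theorem IsSYT.exists_eq_extendFilling {l : YoungDiagram} {T : ℕ × ℕ → ℕ} (hT : IsSYT l T)
    {n : ℕ} (hn : l.card = n + 1) :
    ∃ μ : YoungDiagram, μ.card = n ∧ μ ≤ l ∧ ∃ S, IsSYT μ S ∧ extendFilling l μ S = T := by
  obtain ⟨c, hc, hTc⟩ := hT.1.surjOn (show l.card ∈ Set.Icc 1 l.card from ⟨by omega, le_rfl⟩)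
  have hcl : c ∈ l := hc
  let μ : YoungDiagram :=
    { cells := l.cells.erase c
      isLowerSet := by
        intro b a hab hb
        simp only [Finset.coe_erase, Set.mem_sdiff, Finset.mem_coe, mem_cells,
          Set.mem_singleton_iff] at hb ⊢
        refine ⟨l.isLowerSet hab hb.1, ?_⟩
        rintro rfl
        have h1 := hT.lt_of_le hb.1 hab (Ne.symm hb.2)
        have h2 := (hT.1.mapsTo hb.1).2
        omega }
  have hmem : ∀ x, x ∈ μ ↔ x ≠ c ∧ x ∈ l := by
    intro x; rw [← mem_cells]; simp [μ]
  have hμc : μ.card = n := by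
    have := Finset.card_erase_of_mem hc
    simp only [YoungDiagram.card, μ] at hn ⊢
    omega
  have hlt : ∀ a b : ℕ × ℕ, a ≤ b → a ≠ b → b ∈ μ →
      (if a = c then 0 else T a) < (if b = c then 0 else T b) := by
    intro a b hab hne hb
    have ha : a ∈ μ := μ.isLowerSet hab hb
    rw [if_neg ((hmem a).1 ha).1, if_neg ((hmem b).1 hb).1]
    exact hT.lt_of_le ((hmem b).1 hb).2 hab hne
  refine ⟨μ, hμc, fun x hx => ((hmem x).1 hx).2, fun x => if x = c then 0 else T x,
    ⟨?_, ?_, ?_, ?_⟩, ?_⟩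
  · have h1 := hT.1.sdiff_singleton hc
    have h2 : (μ.cells : Set (ℕ × ℕ)) = (l.cells : Set (ℕ × ℕ)) \ {c} := by simp [μ]
    have h3 : Set.Icc 1 μ.card = Set.Icc 1 l.card \ {T c} := by
      ext k
      simp only [Set.mem_Icc, Set.mem_sdiff, Set.mem_singleton_iff]
      omega
    rw [h2, h3]
    refine h1.congr fun x hx => ?_
    have : x ≠ c := hx.2
    simp [this]
  · intro i j1 j2 h hm
    exact hlt _ _ (Prod.mk_le_mk.2 ⟨le_rfl, h.le⟩) (by simp; omega) hm
  · intro i1 i2 j h hm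
    exact hlt _ _ (Prod.mk_le_mk.2 ⟨h.le, le_rfl⟩) (by simp; omega) hm
  · intro x hx
    by_cases hxc : x = c
    · simp [hxc]
    · have : x ∉ l := fun h => hx ((hmem x).2 ⟨hxc, h⟩)
      simp [hxc, hT.2.2.2 x this]
  · funext x
    by_cases hxc : x = c
    · subst hxc
      simp [extendFilling, hmem, hcl, hTc]
    · by_cases hxl : x ∈ l
      · simp [extendFilling, hmem, hxc, hxl]
      · simp [extendFilling, hmem, hxl, hT.2.2.2 x hxl]

/-- The branching rule for standard Young tableaux. -/
theorem sytCard_eq_sum_covers_below (n : ℕ) (l : YoungDiagram) (hl : l.card = n + 1) :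
    sytCard l = ∑ μ ∈ (ofCard n).filter (· ≤ l), sytCard μ := by
  let D := (ofCard n).filter (· ≤ l)
  have hD : ∀ μ : D, μ.1 ≤ l ∧ μ.1.card + 1 = l.card := by
    rintro ⟨μ, hμ⟩
    simp only [D, Finset.mem_filter, mem_ofCard] at hμ
    exact ⟨hμ.2, by simp only; omega⟩
  let F : (Σ μ : D, {T : ℕ × ℕ → ℕ // IsSYT μ.1 T}) → {T : ℕ × ℕ → ℕ // IsSYT l T} :=
    fun p => ⟨extendFilling l p.1.1 p.2.1, p.2.2.isSYT_extendFilling (hD p.1).1 (hD p.1).2⟩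
  have hF : Function.Bijective F := by
    constructor
    · rintro ⟨μ, T, hT⟩ ⟨ν, S, hS⟩ h
      have h' : extendFilling l μ.1 T = extendFilling l ν.1 S := congrArg Subtype.val h
      obtain rfl : μ = ν := by
        refine Subtype.ext (SetLike.ext fun c => ?_)
        rw [mem_iff_extendFilling_lt hT (hD μ).1 (hD μ).2,
          mem_iff_extendFilling_lt hS (hD ν).1 (hD ν).2, h']
      obtain rfl : T = S := by
        funext c
        by_cases hc : c ∈ μ.1
        · simpa [extendFilling, hc] using congrFun h' c
        · rw [hT.2.2.2 c hc, hS.2.2.2 c hc]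
      rfl
    · rintro ⟨T, hT⟩
      obtain ⟨μ, hμ, hle, S, hS, rfl⟩ := hT.exists_eq_extendFilling hl
      exact ⟨⟨⟨μ, by simp [D, hμ, hle]⟩, S, hS⟩, rfl⟩
  rw [sytCard, ← Nat.card_congr (Equiv.ofBijective F hF), Nat.card_sigma]
  exact Finset.sum_coe_sort D sytCard

theorem sytCard_bot : sytCard ⊥ = 1 := by
  rw [sytCard, Nat.card_eq_one_iff_unique]
  refine ⟨⟨?_⟩, ⟨fun _ => 0, ?_⟩⟩
  · rintro ⟨T, hT⟩ ⟨S, hS⟩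
    refine Subtype.ext (funext fun c => ?_)
    exact (hT.2.2.2 c (notMem_bot c)).trans (hS.2.2.2 c (notMem_bot c)).symm
  · simp [IsSYT, YoungDiagram.card]

theorem sum_sum_filter_eq {α : Type*} [DecidableEq α] {A B : Finset α} (r : α → α → Prop)
    [∀ a b, Decidable (r a b)] (P : α → Prop) [DecidablePred P] (g : α → ℕ) {x : α} (hx : x ∈ B)
    (hA : ∀ a ∈ A, r a x)
    (hB : ∀ b ∈ B, b ≠ x → (A.filter fun a => r a b).card = if P b then 1 else 0) :
    ∑ a ∈ A, ∑ b ∈ B with r a b, g b = A.card * g x + ∑ b ∈ B with b ≠ x ∧ P b, g b := by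
  have h1 : ∑ a ∈ A, ∑ b ∈ B with r a b, g b =
      ∑ b ∈ B, (A.filter fun a => r a b).card * g b := by
    rw [Finset.sum_comm' (t' := B) (s' := fun b => A.filter fun a => r a b)]
    · simp
    · intro a b; simp only [Finset.mem_filter]; tauto
  rw [h1, ← Finset.add_sum_erase _ _ hx, Finset.filter_true_of_mem hA]
  congr 1
  rw [Finset.sum_filter, ← Finset.add_sum_erase B _ hx]
  simp only [ne_eq, not_true_eq_false, false_and, if_false, zero_add]
  refine Finset.sum_congr rfl fun b hb => ?_
  obtain ⟨hne, hb⟩ := Finset.mem_erase.1 hb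
  rw [hB b hb hne]
  by_cases hP : P b <;> simp [hP, hne]

theorem sum_covers_above_below (n : ℕ) (l : YoungDiagram) (hl : l.card = n) (g : YoungDiagram → ℕ) :
    ∑ κ ∈ ofCard (n + 1) with l ≤ κ, ∑ ν ∈ ofCard n with ν ≤ κ, g ν =
      ((ofCard (n + 1)).filter (l ≤ ·)).card * g l +
        ∑ ν ∈ ofCard n with ν ≠ l ∧ (l ⊔ ν).card = n + 1, g ν := by
  refine sum_sum_filter_eq (fun κ ν => ν ≤ κ) (fun ν => (l ⊔ ν).card = n + 1) g
    (by simpa using hl) (fun κ hκ => (Finset.mem_filter.1 hκ).2) fun ν hν hne => ?_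
  rw [mem_ofCard] at hν
  have hlt := card_lt_card_sup (hl.trans hν.symm) hne.symm
  have key : ∀ κ : YoungDiagram, κ.card = n + 1 → l ≤ κ → ν ≤ κ → l ⊔ ν = κ :=
    fun κ h1 h2 h3 => eq_of_le_of_card_le (sup_le h2 h3) (by omega)
  split_ifs with hP
  · refine Finset.card_eq_one.2 ⟨l ⊔ ν, ?_⟩
    ext κ
    simp only [Finset.mem_filter, mem_ofCard, Finset.mem_singleton]
    refine ⟨fun h => (key κ h.1.1 h.1.2 h.2).symm, ?_⟩
    rintro rfl
    exact ⟨⟨hP, le_sup_left⟩, le_sup_right⟩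
  · refine Finset.card_eq_zero.2 (Finset.filter_eq_empty_iff.2 fun κ hκ h => ?_)
    simp only [Finset.mem_filter, mem_ofCard] at hκ
    exact hP (key κ hκ.1 hκ.2 h ▸ hκ.1)

theorem sum_covers_below_above (n : ℕ) (l : YoungDiagram) (hl : l.card = n + 1)
    (g : YoungDiagram → ℕ) :
    ∑ μ ∈ ofCard n with μ ≤ l, ∑ ν ∈ ofCard (n + 1) with μ ≤ ν, g ν =
      ((ofCard n).filter (· ≤ l)).card * g l +
        ∑ ν ∈ ofCard (n + 1) with ν ≠ l ∧ (l ⊔ ν).card = n + 1 + 1, g ν := by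
  refine sum_sum_filter_eq (fun μ ν => μ ≤ ν) (fun ν => (l ⊔ ν).card = n + 1 + 1) g
    (by simpa using hl) (fun κ hκ => (Finset.mem_filter.1 hκ).2) fun ν hν hne => ?_
  rw [mem_ofCard] at hν
  have hlt := card_lt_card_sup (hl.trans hν.symm) hne.symm
  have hsum := card_sup_add_card_inf l ν
  have key : ∀ μ : YoungDiagram, μ.card = n → μ ≤ l → μ ≤ ν → μ = l ⊓ ν :=
    fun μ h1 h2 h3 => eq_of_le_of_card_le (le_inf h2 h3) (by omega)
  split_ifs with hP
  · refine Finset.card_eq_one.2 ⟨l ⊓ ν, ?_⟩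
    ext μ
    simp only [Finset.mem_filter, mem_ofCard, Finset.mem_singleton]
    refine ⟨fun h => key μ h.1.1 h.1.2 h.2, ?_⟩
    rintro rfl
    exact ⟨⟨by omega, inf_le_left⟩, inf_le_right⟩
  · refine Finset.card_eq_zero.2 (Finset.filter_eq_empty_iff.2 fun μ hμ h => hP ?_)
    simp only [Finset.mem_filter, mem_ofCard] at hμ
    have := key μ hμ.1 hμ.2 h ▸ hμ.1
    omega

theorem sum_sytCard_covers_above (n : ℕ) (l : YoungDiagram) (hl : l.card = n) :
    ∑ κ ∈ ofCard (n + 1) with l ≤ κ, sytCard κ = (n + 1) * sytCard l := by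
  induction n generalizing l with
  | zero =>
    have hbot : ∀ μ : YoungDiagram, μ.card = 0 ↔ μ = ⊥ := fun μ => by
      rw [YoungDiagram.ext_iff, YoungDiagram.card, Finset.card_eq_zero, cells_bot]
    have h0 : ofCard 0 = {⊥} := by
      ext μ; simp [hbot]
    obtain rfl := (hbot l).1 hl
    have h1 := card_covers_above 0 ⊥ hl
    have hr : (⊥ : YoungDiagram).removableRows = ∅ := by
      refine Finset.eq_empty_of_forall_notMem fun i hi => ?_
      have := mem_removableRows.1 hi
      exact notMem_bot _ (mem_iff_lt_rowLen.2 (this.trans_le' (Nat.zero_le _)))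
    rw [hr, Finset.card_empty] at h1
    rw [Finset.sum_congr rfl (g := fun _ => 1), Finset.sum_const, h1, sytCard_bot]
    · rfl
    · intro κ hκ
      simp only [Finset.mem_filter, mem_ofCard] at hκ
      rw [sytCard_eq_sum_covers_below 0 κ hκ.1, h0,
        Finset.filter_true_of_mem (by simp), Finset.sum_singleton, sytCard_bot]
  | succ n ih =>
    have hup : ∑ κ ∈ ofCard (n + 1 + 1) with l ≤ κ, sytCard κ =
        ∑ κ ∈ ofCard (n + 1 + 1) with l ≤ κ, ∑ ν ∈ ofCard (n + 1) with ν ≤ κ, sytCard ν :=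
      Finset.sum_congr rfl fun κ hκ => by
        simp only [Finset.mem_filter, mem_ofCard] at hκ
        exact sytCard_eq_sum_covers_below _ _ hκ.1
    have hdown : ∑ μ ∈ ofCard n with μ ≤ l, ∑ ν ∈ ofCard (n + 1) with μ ≤ ν, sytCard ν =
        (n + 1) * sytCard l := by
      rw [sytCard_eq_sum_covers_below n l hl, Finset.mul_sum]
      refine Finset.sum_congr rfl fun μ hμ => ?_
      simp only [Finset.mem_filter, mem_ofCard] at hμ
      exact ih μ hμ.1
    rw [sum_covers_below_above n l hl, card_covers_below n l hl] at hdown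
    rw [hup, sum_covers_above_below _ l hl, card_covers_above _ l hl]
    linarith

theorem ncard_removable (n : ℕ) (l : YoungDiagram) (hl : l.card = n + 1) :
    {c : ℕ × ℕ | Removable l c}.ncard = ((ofCard n).filter (· ≤ l)).card := by
  rw [← Set.ncard_coe_finset]
  refine Set.ncard_congr (fun c hc => hc.2.choose) ?_ ?_ ?_
  · intro c hc
    have h := hc.2.choose_spec
    have h1 := Finset.card_erase_of_mem ((mem_cells c).2 hc.1)
    simp only [Finset.coe_filter, Set.mem_ofPred_eq, mem_ofCard]
    refine ⟨?_, ?_⟩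
    · simp only [YoungDiagram.card] at hl ⊢
      rw [h]
      omega
    · rw [← cells_subset_iff, h]
      exact Finset.erase_subset _ _
  · intro c d hc hd h
    have h1 := hc.2.choose_spec
    have h2 := hd.2.choose_spec
    simp only [h, h2] at h1
    exact (Finset.erase_inj _ ((mem_cells d).2 hd.1)).1 h1 |>.symm
  · intro μ hμ
    simp only [Finset.coe_filter, Set.mem_ofPred_eq, mem_ofCard] at hμ
    obtain ⟨c, hc, hins⟩ := exists_cells_eq_insert hμ.2 (by omega)
    have hcell : μ.cells = l.cells.erase c := by
      rw [hins, Finset.erase_insert (by simpa using hc)]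
    have hrem : Removable l c := ⟨by rw [← mem_cells, hins]; simp, μ, hcell⟩
    exact ⟨c, hrem, YoungDiagram.ext (hrem.2.choose_spec.trans hcell.symm)⟩

/-- if `λ ⊢ n` has exactly `m` removable squares, then
`m·f_λ + Σ_{ν ∈ Λ⁺⁻} f_ν = n · Σ_{μ ∈ Λ⁻} f_μ`. -/
theorem sum_upward_from_below (n m : ℕ) (l : YoungDiagram) (hl : l.card = n)
    (hm : {c : ℕ × ℕ | Removable l c}.ncard = m) :
    m * sytCard l +
      ∑ᶠ ν ∈ {ν : YoungDiagram | ν.card = n ∧ ν ≠ l ∧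
          ∃ κ : YoungDiagram, l ≤ κ ∧ κ.card = n + 1 ∧ ν ≤ κ}, sytCard ν =
    n * ∑ᶠ μ ∈ {μ : YoungDiagram | μ ≤ l ∧ μ.card + 1 = n}, sytCard μ := by
  have hS : {ν : YoungDiagram | ν.card = n ∧ ν ≠ l ∧
      ∃ κ : YoungDiagram, l ≤ κ ∧ κ.card = n + 1 ∧ ν ≤ κ} =
      ((ofCard n).filter fun ν => ν ≠ l ∧ (l ⊔ ν).card = n + 1 : Finset YoungDiagram) := by
    ext ν
    simp only [Set.mem_ofPred_eq, Finset.coe_filter, mem_ofCard]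
    refine and_congr_right fun hν => and_congr_right fun hne => ⟨?_, fun h =>
      ⟨l ⊔ ν, le_sup_left, h, le_sup_right⟩⟩
    rintro ⟨κ, h1, h2, h3⟩
    have := card_lt_card_sup (hl.trans hν.symm) hne.symm
    have := card_le_card (sup_le h1 h3)
    omega
  rw [hS, finsum_mem_coe_finset]
  rcases n with _ | n
  · have h0 : l.cells = ∅ := Finset.card_eq_zero.1 hl
    have hr : {c : ℕ × ℕ | Removable l c} = ∅ := by
      ext c
      simp [Removable, ← mem_cells, h0]
    rw [hr, Set.ncard_empty] at hm
    rw [← hm, zero_mul, zero_mul, zero_add]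
    refine Finset.sum_eq_zero fun ν hν => ?_
    simp only [Finset.mem_filter, mem_ofCard] at hν
    exact absurd (YoungDiagram.ext ((Finset.card_eq_zero.1 hν.1).trans h0.symm)) hν.2.1
  · have hD : {μ : YoungDiagram | μ ≤ l ∧ μ.card + 1 = n + 1} =
        ((ofCard n).filter (· ≤ l) : Finset YoungDiagram) := by
      ext μ
      simp [and_comm]
    rw [hD, finsum_mem_coe_finset, ← hm, ncard_removable n l hl,
      ← sum_covers_below_above n l hl, Finset.mul_sum]
    refine Finset.sum_congr rfl fun μ hμ => ?_
    simp only [Finset.mem_filter, mem_ofCard] at hμ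
    exact sum_sytCard_covers_above n μ hμ.1
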